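/- arXiv:1712.06729 — 7 statements merged into one kernel-verified Lean document; each statement's English description precedes it below -/
import Mathlib

section
/- Let A be a 2M×2M real symmetric matrix such that X_{2M}A is symmetric, and assume I_{2M} − X_{2M}A is invertible. Then the matrix σ_A = (I_{2M} − X_{2M}A)^{−1} − (1/2)I_{2M} is positive definite if and only if every eigenvalue λ of A satisfies |λ| < 1. -/
open Matrix

/-- A real symmetric matrix `A` satisfies `0 < 1 - A ^ 2` in the Loewner sense exactly when its
spectrum lies in the open interval `(-1, 1)`. -/
theorem Matrix.IsHermitian.posDef_one_sub_mul_self_iff {n : Type*} [Fintype n] [DecidableEq n]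
    {A : Matrix n n ℝ} (hA : A.IsHermitian) :
    (1 - A * A).PosDef ↔ ∀ μ ∈ spectrum ℝ A, |μ| < 1 := by
  have hH : (1 - A * A).IsHermitian := by
    rw [Matrix.IsHermitian, conjTranspose_sub, conjTranspose_mul, conjTranspose_one, hA.eq]
  have factor (s : ℝ) : algebraMap ℝ (Matrix n n ℝ) (1 - s ^ 2) - (1 - A * A) =
      -((algebraMap ℝ (Matrix n n ℝ) s - A) * (algebraMap ℝ (Matrix n n ℝ) s + A)) := by
    have hc : algebraMap ℝ (Matrix n n ℝ) s * A = A * algebraMap ℝ (Matrix n n ℝ) s :=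
      Algebra.commutes s A
    simp only [map_sub, map_one, pow_two, map_mul, sub_mul, mul_add, hc]
    abel
  have mem_iff (s : ℝ) : 1 - s ^ 2 ∈ spectrum ℝ (1 - A * A) ↔
      s ∈ spectrum ℝ A ∨ -s ∈ spectrum ℝ A := by
    have hneg : algebraMap ℝ (Matrix n n ℝ) (-s) - A =
        -(algebraMap ℝ (Matrix n n ℝ) s + A) := by
      rw [map_neg]; abel
    rw [spectrum.mem_iff, spectrum.mem_iff, spectrum.mem_iff, factor, hneg, IsUnit.neg_iff,
      IsUnit.neg_iff, Matrix.isUnit_iff_isUnit_det, Matrix.isUnit_iff_isUnit_det,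
      Matrix.isUnit_iff_isUnit_det, det_mul, IsUnit.mul_iff, not_and_or]
  rw [hH.posDef_iff_eigenvalues_pos]
  constructor
  · intro h μ hμ
    have hmem := (mem_iff μ).2 (Or.inl hμ)
    rw [hH.spectrum_real_eq_range_eigenvalues] at hmem
    obtain ⟨i, hi⟩ := hmem
    have := h i
    rw [← sq_lt_one_iff_abs_lt_one]
    linarith
  · intro h i
    by_contra! hi
    have hmem := hH.eigenvalues_mem_spectrum_real i
    set ν := hH.eigenvalues i
    have hs : Real.sqrt (1 - ν) ^ 2 = 1 - ν := Real.sq_sqrt (by linarith)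
    have hν : ν = 1 - Real.sqrt (1 - ν) ^ 2 := by linarith
    rw [hν, mem_iff] at hmem
    have hlt : |Real.sqrt (1 - ν)| < 1 := by
      rcases hmem with hmem | hmem
      · exact h _ hmem
      · simpa using h _ hmem
    rw [← sq_lt_one_iff_abs_lt_one] at hlt
    linarith

/-- For a Hermitian `B` with `1 - B` invertible, `(1 - B)⁻¹ - 1 / 2` is congruent to a positive
multiple of `1 - B ^ 2`. -/
theorem Matrix.IsHermitian.posDef_inv_one_sub_sub_half_iff {n : Type*} [Fintype n] [DecidableEq n]
    {B : Matrix n n ℝ} (hB : B.IsHermitian) (hinv : IsUnit (1 - B)) :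
    ((1 - B)⁻¹ - (1 / 2 : ℝ) • (1 : Matrix n n ℝ)).PosDef ↔ (1 - B * B).PosDef := by
  have hstar : star (1 - B) = 1 - B := by
    rw [star_eq_conjTranspose, conjTranspose_sub, conjTranspose_one, hB.eq]
  have hdet := (Matrix.isUnit_iff_isUnit_det _).1 hinv
  have key : star (1 - B) * ((1 - B)⁻¹ - (1 / 2 : ℝ) • (1 : Matrix n n ℝ)) * (1 - B) =
      (1 / 2 : ℝ) • (1 - B * B) := by
    rw [hstar, mul_sub (1 - B), mul_nonsing_inv _ hdet]
    simp only [mul_smul_comm, smul_mul_assoc, sub_mul, mul_sub, one_mul, mul_one]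
    module
  rw [← hinv.posDef_star_left_conjugate_iff, key]
  refine ⟨fun h => ?_, fun h => h.smul (by norm_num)⟩
  simpa [smul_smul] using h.smul (show (0 : ℝ) < 2 by norm_num)

theorem stmt_2 (M : ℕ) (A : Matrix (Fin M ⊕ Fin M) (Fin M ⊕ Fin M) ℝ)
    (hA : A.IsSymm)
    (hXA : ((Matrix.fromBlocks 0 1 1 0 : Matrix (Fin M ⊕ Fin M) (Fin M ⊕ Fin M) ℝ) * A).IsSymm)
    (hinv : IsUnit ((1 : Matrix (Fin M ⊕ Fin M) (Fin M ⊕ Fin M) ℝ) -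
      Matrix.fromBlocks 0 1 1 0 * A)) :
    (((1 : Matrix (Fin M ⊕ Fin M) (Fin M ⊕ Fin M) ℝ) -
        Matrix.fromBlocks 0 1 1 0 * A)⁻¹ -
      (1 / 2 : ℝ) • (1 : Matrix (Fin M ⊕ Fin M) (Fin M ⊕ Fin M) ℝ)).PosDef ↔
    ∀ μ ∈ spectrum ℝ A, |μ| < 1 := by
  set X : Matrix (Fin M ⊕ Fin M) (Fin M ⊕ Fin M) ℝ := fromBlocks 0 1 1 0 with hX
  have hXX : X * X = 1 := by simp [hX, fromBlocks_multiply]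
  have hXT : Xᵀ = X := by simp [hX, fromBlocks_transpose]
  have hcomm : X * A = A * X := by
    rw [← hXA.eq, transpose_mul, hXT, hA.eq]
  have hsq : X * A * (X * A) = A * A := by
    nth_rewrite 1 [hcomm]
    rw [mul_assoc, ← mul_assoc X X A, hXX, one_mul]
  have hAH : A.IsHermitian := by rw [IsHermitian, conjTranspose_eq_transpose_of_trivial, hA.eq]
  have hXAH : (X * A).IsHermitian := by
    rw [IsHermitian, conjTranspose_eq_transpose_of_trivial, hXA.eq]
  rw [hXAH.posDef_inv_one_sub_sub_half_iff hinv, hsq, hAH.posDef_one_sub_mul_self_iff]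
end

section
/- Let A₁₁ and A₁₂ be commuting real symmetric M×M matrices with common orthonormal eigenbasis v₁,…,v_M, A₁₁ v_k = f_k v_k, A₁₂ v_k = h_k v_k, and let A = [[A₁₁, A₁₂],[A₁₂, A₁₁]]. Let c be a real number with c(h_k + f_k) ≠ 1 and c(h_k − f_k) ≠ 1 for all k. Then I_{2M} − X_{2M}(cA) is invertible and the spectrum, with multiplicity, of σ_{cA} = (I_{2M} − X_{2M}(cA))^{−1} − (1/2)I_{2M} is the multiset {(1/2)(1 + c(h_k + f_k))/(1 − c(h_k + f_k)) : k = 1,…,M} ∪ {(1/2)(1 + c(h_k − f_k))/(1 − c(h_k − f_k)) : k = 1,…,M}. -/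
open Matrix Polynomial

namespace Matrix

/-- A matrix diagonalized with nonzero eigenvalues is a unit, and the characteristic polynomial of
a scalar shift of its inverse is given by the shifted reciprocals of the eigenvalues. -/
theorem isUnit_and_charpoly_inv_sub_smul_one_of_diagonalized {n K : Type*} [Fintype n]
    [DecidableEq n] [Field K] {N P Q : Matrix n n K} {d : n → K} (hQP : Q * P = 1)
    (hN : N * P = P * diagonal d) (hd : ∀ i, d i ≠ 0) (a : K) :
    IsUnit N ∧ (N⁻¹ - a • (1 : Matrix n n K)).charpoly = ∏ i, (X - C ((d i)⁻¹ - a)) := by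
  have hPQ : P * Q = 1 := mul_eq_one_comm.mp hQP
  have hdd : diagonal d * diagonal (fun i => (d i)⁻¹) = 1 := by
    rw [diagonal_mul_diagonal, ← diagonal_one]
    congr 1
    ext i
    exact mul_inv_cancel₀ (hd i)
  have hinv : N * (P * diagonal (fun i => (d i)⁻¹) * Q) = 1 := by
    rw [← mul_assoc, ← mul_assoc, hN, mul_assoc P, hdd, mul_one, hPQ]
  refine ⟨IsUnit.of_mul_eq_one _ hinv, ?_⟩
  have hshift : N⁻¹ - a • (1 : Matrix n n K) = P * diagonal (fun i => (d i)⁻¹ - a) * Q := by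
    have hdiag : diagonal (fun i => (d i)⁻¹ - a) =
        diagonal (fun i => (d i)⁻¹) - a • (1 : Matrix n n K) := by
      rw [smul_one_eq_diagonal, diagonal_sub]
    rw [inv_eq_right_inv hinv, hdiag, mul_sub, sub_mul, mul_smul_comm, smul_mul_assoc, mul_one,
      hPQ]
  rw [hshift, charpoly_mul_comm, ← mul_assoc, hQP, one_mul, charpoly_diagonal]

/-- Stacking `n` linear eigenvector equations into a matrix identity. -/
theorem mul_transpose_of_eq_mul_diagonal {n R : Type*} [Fintype n] [DecidableEq n] [CommSemiring R]
    {A : Matrix n n R} {v : n → n → R} {f : n → R} (hf : ∀ k, A *ᵥ v k = f k • v k) :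
    A * (of v)ᵀ = (of v)ᵀ * diagonal f := by
  ext i k
  rw [mul_diagonal]
  exact (congrFun (hf k) i).trans (mul_comm _ _)

end Matrix

theorem stmt_5 (M : ℕ) (A11 A12 : Matrix (Fin M) (Fin M) ℝ)
    (h11 : A11.IsSymm) (h12 : A12.IsSymm) (hcomm : A11 * A12 = A12 * A11)
    (v : Fin M → Fin M → ℝ)
    (horth : ∀ k l, v k ⬝ᵥ v l = if k = l then (1 : ℝ) else 0)
    (f h : Fin M → ℝ)
    (hf : ∀ k, A11 *ᵥ v k = f k • v k)
    (hh : ∀ k, A12 *ᵥ v k = h k • v k)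
    (c : ℝ)
    (hc1 : ∀ k, c * (h k + f k) ≠ 1)
    (hc2 : ∀ k, c * (h k - f k) ≠ 1) :
    IsUnit ((1 : Matrix (Fin M ⊕ Fin M) (Fin M ⊕ Fin M) ℝ) -
        Matrix.fromBlocks 0 1 1 0 * (c • Matrix.fromBlocks A11 A12 A12 A11)) ∧
    (((1 : Matrix (Fin M ⊕ Fin M) (Fin M ⊕ Fin M) ℝ) -
        Matrix.fromBlocks 0 1 1 0 * (c • Matrix.fromBlocks A11 A12 A12 A11))⁻¹ -
      (1 / 2 : ℝ) • (1 : Matrix (Fin M ⊕ Fin M) (Fin M ⊕ Fin M) ℝ)).charpoly =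
      ∏ k : Fin M,
        ((X - C ((1 / 2) * (1 + c * (h k + f k)) / (1 - c * (h k + f k)))) *
         (X - C ((1 / 2) * (1 + c * (h k - f k)) / (1 - c * (h k - f k))))) := by
  have horthV : of v * (of v)ᵀ = 1 := by
    ext k l
    rw [one_apply]
    exact horth k l
  have hVf := mul_transpose_of_eq_mul_diagonal hf
  have hVh := mul_transpose_of_eq_mul_diagonal hh
  set V := (of v)ᵀ
  have hQP : fromBlocks ((1 / 2 : ℝ) • of v) ((1 / 2 : ℝ) • of v) ((1 / 2 : ℝ) • of v)
      (-((1 / 2 : ℝ) • of v)) * fromBlocks V V V (-V) = 1 := by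
    rw [fromBlocks_multiply, ← fromBlocks_one]
    simp only [smul_mul_assoc, mul_neg, neg_mul, horthV, neg_neg, add_neg_cancel, ← add_smul]
    norm_num
  let d : Fin M ⊕ Fin M → ℝ :=
    Sum.elim (fun k => 1 - c * (h k + f k)) (fun k => 1 - c * (h k - f k))
  have hplus : diagonal (fun k => 1 - c * (h k + f k)) =
      1 - c • (diagonal h + diagonal f) := by
    rw [diagonal_add, ← diagonal_smul, ← diagonal_one, diagonal_sub]
    rfl
  have hminus : diagonal (fun k => 1 - c * (h k - f k)) =
      1 - c • (diagonal h - diagonal f) := by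
    rw [diagonal_sub, ← diagonal_smul, ← diagonal_one, diagonal_sub]
    rfl
  have hN : (1 - fromBlocks 0 1 1 0 * (c • fromBlocks A11 A12 A12 A11)) * fromBlocks V V V (-V) =
      fromBlocks V V V (-V) * diagonal d := by
    rw [← fromBlocks_diagonal, hplus, hminus, sub_mul, one_mul, mul_smul_comm, smul_mul_assoc,
      fromBlocks_multiply, fromBlocks_multiply, fromBlocks_multiply, fromBlocks_smul,
      sub_eq_add_neg, fromBlocks_neg, fromBlocks_add]
    simp only [zero_mul, one_mul, zero_add, add_zero, mul_zero, mul_neg, neg_mul, hVf, hVh,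
      mul_sub, mul_one, mul_smul_comm, mul_add]
    congr 1 <;> module
  have hd : ∀ i, d i ≠ 0 := by
    rintro (k | k)
    · exact sub_ne_zero.mpr (hc1 k).symm
    · exact sub_ne_zero.mpr (hc2 k).symm
  have hcayley : ∀ x : ℝ, 1 - x ≠ 0 → (1 - x)⁻¹ - 1 / 2 = 1 / 2 * (1 + x) / (1 - x) := by
    intro x hx
    field_simp
    ring
  obtain ⟨hunit, hchar⟩ :=
    isUnit_and_charpoly_inv_sub_smul_one_of_diagonalized hQP hN hd (1 / 2)
  refine ⟨hunit, hchar.trans ?_⟩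
  rw [Fintype.prod_sum_type, ← Finset.prod_mul_distrib]
  refine Finset.prod_congr rfl fun k _ => ?_
  rw [← hcayley _ (hd (Sum.inl k)), ← hcayley _ (hd (Sum.inr k))]
  rfl
end

section
/- Let A₁₁ and A₁₂ be commuting real symmetric M×M matrices with common orthonormal eigenbasis v₁,…,v_M, A₁₁ v_k = f_k v_k, A₁₂ v_k = h_k v_k, and let A = [[A₁₁, A₁₂],[A₁₂, A₁₁]]. Let c > 0 satisfy c|h_k + f_k| < 1 and c|h_k − f_k| < 1 for all k. If additionally A₁₂ is positive semidefinite (equivalently h_k ≥ 0 for all k), then the matrix σ_{cA} + (1/2)Z_{2M} is positive semidefinite; i.e., σ_{cA} satisfies the uncertainty principle of a valid Gaussian covariance matrix. -/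
open Matrix

/-- A real matrix with an orthonormal eigenbasis of positive eigenvalues is positive definite. -/
theorem posDef_of_orthonormal_eigenbasis {n : Type*} [Fintype n] [DecidableEq n]
    {S : Matrix n n ℝ} {v : n → n → ℝ} {s : n → ℝ}
    (horth : ∀ k l, v k ⬝ᵥ v l = if k = l then (1 : ℝ) else 0)
    (hS : ∀ k, S *ᵥ v k = s k • v k) (hs : ∀ k, 0 < s k) : S.PosDef := by
  have hV : Matrix.of v * star (Matrix.of v) = 1 := by
    ext k l
    simpa [Matrix.mul_apply, dotProduct, Matrix.one_apply] using horth k l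
  have hU : IsUnit (Matrix.of v) := IsUnit.of_mul_eq_one _ hV
  rw [← hU.posDef_star_right_conjugate_iff]
  have hdiag : Matrix.of v * S * star (Matrix.of v) = diagonal s := by
    ext k l
    have h1 : (Matrix.of v * S * star (Matrix.of v)) k l = v k ⬝ᵥ (S *ᵥ v l) := by
      rw [dotProduct_mulVec]
      simp [Matrix.mul_apply, dotProduct, vecMul]
    rw [h1, hS, dotProduct_smul, horth, diagonal_apply]
    split_ifs with hkl <;> simp [hkl]
  rw [hdiag]
  exact PosDef.diagonal hs

theorem posDef_fromBlocks_zero {m n : Type*} [Fintype m] [Fintype n]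
    {P : Matrix m m ℝ} {Q : Matrix n n ℝ} (hP : P.PosDef) (hQ : Q.PosDef) :
    (fromBlocks P 0 0 Q).PosDef := by
  refine PosDef.of_dotProduct_mulVec_pos
    (hP.isHermitian.fromBlocks (by simp) hQ.isHermitian) fun x hx => ?_
  have hsum : star x ⬝ᵥ (fromBlocks P 0 0 Q *ᵥ x) =
      star (x ∘ Sum.inl) ⬝ᵥ (P *ᵥ (x ∘ Sum.inl)) +
        star (x ∘ Sum.inr) ⬝ᵥ (Q *ᵥ (x ∘ Sum.inr)) := by
    simp [fromBlocks_mulVec, dotProduct, Fintype.sum_sum_type]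
  rw [hsum]
  by_cases h0 : x ∘ Sum.inl = 0
  · have h1 : x ∘ Sum.inr ≠ 0 := fun h1 => hx <| by
      ext (i | i)
      exacts [congrFun h0 i, congrFun h1 i]
    exact add_pos_of_nonneg_of_pos (hP.posSemidef.dotProduct_mulVec_nonneg _)
      (hQ.dotProduct_mulVec_pos h1)
  · exact add_pos_of_pos_of_nonneg (hP.dotProduct_mulVec_pos h0)
      (hQ.posSemidef.dotProduct_mulVec_nonneg _)

/-- A block matrix `[[P, Q], [Q, P]]` is positive definite if `P + Q` and `P - Q` are. -/
theorem posDef_fromBlocks_of_add_of_sub {n : Type*} [Fintype n] [DecidableEq n]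
    {P Q : Matrix n n ℝ} (hadd : (P + Q).PosDef) (hsub : (P - Q).PosDef) :
    (fromBlocks P Q Q P).PosDef := by
  set T : Matrix (n ⊕ n) (n ⊕ n) ℝ := fromBlocks 1 1 1 (-1) with hTdef
  have hstar : star T = T := by
    rw [hTdef, star_eq_conjTranspose, fromBlocks_conjTranspose]
    simp
  have hT : IsUnit T := by
    refine IsUnit.of_mul_eq_one ((1 / 2 : ℝ) • T) ?_
    rw [← fromBlocks_one, hTdef, fromBlocks_smul, fromBlocks_multiply]
    congr 1 <;> simp <;> module
  rw [← hT.posDef_star_left_conjugate_iff, hstar]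
  have hconj : T * fromBlocks P Q Q P * T =
      (2 : ℝ) • fromBlocks (P + Q) 0 0 (P - Q) := by
    rw [hTdef, fromBlocks_smul, fromBlocks_multiply, fromBlocks_multiply]
    congr 1 <;> simp <;> module
  rw [hconj]
  exact (posDef_fromBlocks_zero hadd hsub).smul two_pos

/-- For `W` positive definite and `1 - Bᴴ W B` positive semidefinite, so is `W⁻¹ - B Bᴴ`. -/
theorem posSemidef_inv_sub_mul_conjTranspose {m n : Type*} [Fintype m] [Fintype n]
    [DecidableEq m] [DecidableEq n] {W : Matrix m m ℝ} (hW : W.PosDef) {B : Matrix m n ℝ}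
    (hB : (1 - Bᴴ * W * B).PosSemidef) : (W⁻¹ - B * Bᴴ).PosSemidef := by
  let _ := hW.isUnit.invertible
  let _ := hW.inv.isUnit.invertible
  let _ : Invertible (1 : Matrix n n ℝ) := invertibleOne
  have h1 : (fromBlocks W⁻¹ B Bᴴ 1).PosSemidef :=
    (hW.inv.fromBlocks₁₁ B 1).2 (by rwa [inv_inv_of_invertible])
  simpa using (PosDef.fromBlocks₂₂ W⁻¹ B PosDef.one).1 h1

theorem stmt_7 (M : ℕ) (A11 A12 : Matrix (Fin M) (Fin M) ℝ)
    (h11 : A11.IsSymm) (h12 : A12.IsSymm) (hcomm : A11 * A12 = A12 * A11)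
    (v : Fin M → Fin M → ℝ)
    (horth : ∀ k l, v k ⬝ᵥ v l = if k = l then (1 : ℝ) else 0)
    (f h : Fin M → ℝ)
    (hf : ∀ k, A11 *ᵥ v k = f k • v k)
    (hh : ∀ k, A12 *ᵥ v k = h k • v k)
    (c : ℝ) (hc : 0 < c)
    (hc1 : ∀ k, c * |h k + f k| < 1)
    (hc2 : ∀ k, c * |h k - f k| < 1)
    (hpsd : A12.PosSemidef) (hhk : ∀ k, 0 ≤ h k) :
    ((((1 : Matrix (Fin M ⊕ Fin M) (Fin M ⊕ Fin M) ℝ) -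
          Matrix.fromBlocks 0 1 1 0 * (c • Matrix.fromBlocks A11 A12 A12 A11))⁻¹ -
        (1 / 2 : ℝ) • (1 : Matrix (Fin M ⊕ Fin M) (Fin M ⊕ Fin M) ℝ)) +
      (1 / 2 : ℝ) • (Matrix.fromBlocks 1 0 0 (-1) :
        Matrix (Fin M ⊕ Fin M) (Fin M ⊕ Fin M) ℝ)).PosSemidef := by
  have hW : (fromBlocks (1 - c • A12) (-(c • A11)) (-(c • A11)) (1 - c • A12)).PosDef := by
    refine posDef_fromBlocks_of_add_of_sub
      (posDef_of_orthonormal_eigenbasis (s := fun k => 1 - c * (h k + f k)) horth ?_ ?_)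
      (posDef_of_orthonormal_eigenbasis (s := fun k => 1 - c * (h k - f k)) horth ?_ ?_)
    · intro k
      rw [add_mulVec, sub_mulVec, neg_mulVec, smul_mulVec, smul_mulVec, one_mulVec, hf, hh]
      module
    · intro k
      have := mul_le_mul_of_nonneg_left (le_abs_self (h k + f k)) hc.le
      linarith [hc1 k]
    · intro k
      rw [sub_mulVec, sub_mulVec, neg_mulVec, smul_mulVec, smul_mulVec, one_mulVec, hf, hh]
      module
    · intro k
      have := mul_le_mul_of_nonneg_left (le_abs_self (h k - f k)) hc.le
      linarith [hc2 k]
  have hWeq : (1 : Matrix (Fin M ⊕ Fin M) (Fin M ⊕ Fin M) ℝ) -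
      fromBlocks 0 1 1 0 * (c • fromBlocks A11 A12 A12 A11) =
        fromBlocks (1 - c • A12) (-(c • A11)) (-(c • A11)) (1 - c • A12) := by
    rw [← fromBlocks_one, fromBlocks_smul, fromBlocks_multiply, sub_eq_add_neg,
      fromBlocks_neg, fromBlocks_add]
    simp [sub_eq_add_neg]
  rw [hWeq]
  have hpos := posSemidef_inv_sub_mul_conjTranspose hW
    (B := fromRows (0 : Matrix (Fin M) (Fin M) ℝ) 1) (by
      rw [conjTranspose_fromRows_eq_fromCols_conjTranspose, Matrix.mul_assoc,
        fromBlocks_mul_fromRows, fromCols_mul_fromRows]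
      simpa using hpsd.smul hc.le)
  convert! hpos using 1
  rw [sub_add, sub_right_inj, conjTranspose_fromRows_eq_fromCols_conjTranspose,
    fromRows_mul_fromCols, ← fromBlocks_one, fromBlocks_smul, fromBlocks_smul, sub_eq_add_neg,
    fromBlocks_neg, fromBlocks_add]
  congr 1 <;> simp
  module
end

section
/- Let A be a 2M×2M real symmetric matrix with eigenvalues λ₁,…,λ_{2M} (with multiplicity), and let c > 0 satisfy c|λ_k| < 1 for all k. Form the 4M×4M block-diagonal matrix A ⊕ A = [[A, 0],[0, A]]. Then I_{4M} − X_{4M}·c(A ⊕ A) is invertible, and the spectrum, with multiplicity, of σ_{c(A⊕A)} = (I_{4M} − X_{4M}·c(A⊕A))^{−1} − (1/2)I_{4M} is the multiset {(1/2)(1 + cλ_k)/(1 − cλ_k) : k = 1,…,2M} ∪ {(1/2)(1 − cλ_k)/(1 + cλ_k) : k = 1,…,2M}. -/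
open Matrix Polynomial

section

variable {n : Type*} [Fintype n] [DecidableEq n]

/-- The determinant of a block matrix with equal diagonal blocks and equal off-diagonal blocks. -/
theorem Matrix.det_fromBlocks_swap_symm {R : Type*} [CommRing R] (S T : Matrix n n R) :
    (fromBlocks S T T S).det = (S + T).det * (S - T).det := by
  have h : fromBlocks 1 0 (-1) 1 * fromBlocks S T T S * fromBlocks 1 0 1 1 =
      fromBlocks (S + T) T 0 (S - T) := by
    simp only [fromBlocks_multiply]
    congr 1 <;> simp <;> abel
  have h' := congrArg det h
  simpa [det_mul, det_fromBlocks_zero₁₂, det_fromBlocks_zero₂₁] using h'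

/-- If the characteristic polynomial splits, so does the homogeneous form `det (s - b A)`. -/
theorem Matrix.det_smul_one_sub_smul_of_charpoly_eq {K : Type*} [Field K] {A : Matrix n n K}
    {lam : n → K} (hlam : A.charpoly = ∏ k, (X - C (lam k))) (s b : K) :
    (s • (1 : Matrix n n K) - b • A).det = ∏ k, (s - b * lam k) := by
  rcases eq_or_ne b 0 with rfl | hb
  · simp
  · have h : s • (1 : Matrix n n K) - b • A = b • (scalar n (s / b) - A) := by
      rw [scalar_apply, ← smul_one_eq_diagonal, smul_sub, smul_smul, mul_div_cancel₀ _ hb]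
    rw [h, det_smul, ← eval_charpoly, hlam, eval_prod, ← Finset.card_univ, ← Finset.prod_const,
      ← Finset.prod_mul_distrib]
    refine Finset.prod_congr rfl fun k _ ↦ ?_
    simp only [eval_sub, eval_X, eval_C]
    field_simp

theorem Matrix.det_fromBlocks_smul_of_charpoly_eq {K : Type*} [Field K] {A : Matrix n n K}
    {lam : n → K} (hlam : A.charpoly = ∏ k, (X - C (lam k))) (s b : K) :
    (s • (1 : Matrix (n ⊕ n) (n ⊕ n) K) -
      fromBlocks 0 1 1 0 * (b • fromBlocks A 0 0 A)).det =
      ∏ k, ((s - b * lam k) * (s + b * lam k)) := by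
  have h : s • (1 : Matrix (n ⊕ n) (n ⊕ n) K) -
      fromBlocks 0 1 1 0 * (b • fromBlocks A 0 0 A) =
      fromBlocks (s • 1) (-(b • A)) (-(b • A)) (s • 1) := by
    rw [← fromBlocks_one, fromBlocks_smul, fromBlocks_smul, fromBlocks_multiply, sub_eq_add_neg,
      fromBlocks_neg, fromBlocks_add]
    simp
  have h' := det_smul_one_sub_smul_of_charpoly_eq hlam s (-b)
  rw [neg_smul] at h'
  rw [h, det_fromBlocks_swap_symm, ← sub_eq_add_neg, h',
    det_smul_one_sub_smul_of_charpoly_eq hlam, ← Finset.prod_mul_distrib]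
  simp

end

open Matrix Polynomial

theorem stmt_10 (M : ℕ) (A : Matrix (Fin (2 * M)) (Fin (2 * M)) ℝ)
    (hA : A.IsSymm)
    (lam : Fin (2 * M) → ℝ)
    (hlam : A.charpoly = ∏ k : Fin (2 * M), (X - C (lam k)))
    (c : ℝ) (hc : 0 < c) (hclam : ∀ k, c * |lam k| < 1) :
    IsUnit ((1 : Matrix (Fin (2 * M) ⊕ Fin (2 * M)) (Fin (2 * M) ⊕ Fin (2 * M)) ℝ) -
        Matrix.fromBlocks 0 1 1 0 * (c • Matrix.fromBlocks A 0 0 A)) ∧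
    (((1 : Matrix (Fin (2 * M) ⊕ Fin (2 * M)) (Fin (2 * M) ⊕ Fin (2 * M)) ℝ) -
        Matrix.fromBlocks 0 1 1 0 * (c • Matrix.fromBlocks A 0 0 A))⁻¹ -
      (1 / 2 : ℝ) •
        (1 : Matrix (Fin (2 * M) ⊕ Fin (2 * M)) (Fin (2 * M) ⊕ Fin (2 * M)) ℝ)).charpoly =
      ∏ k : Fin (2 * M),
        ((X - C ((1 / 2) * (1 + c * lam k) / (1 - c * lam k))) *
         (X - C ((1 / 2) * (1 - c * lam k) / (1 + c * lam k)))) := by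
  have hpos (k : Fin (2 * M)) : 0 < 1 - c * lam k ∧ 0 < 1 + c * lam k := by
    have h := hclam k
    rw [← abs_of_pos hc, ← abs_mul, abs_lt] at h
    constructor <;> linarith
  have hdet := det_fromBlocks_smul_of_charpoly_eq hlam 1 c
  rw [one_smul] at hdet
  set B := (1 : Matrix (Fin (2 * M) ⊕ Fin (2 * M)) (Fin (2 * M) ⊕ Fin (2 * M)) ℝ) -
    fromBlocks 0 1 1 0 * (c • fromBlocks A 0 0 A) with hB
  have hne : B.det ≠ 0 := by
    rw [hdet]
    exact Finset.prod_ne_zero_iff.mpr fun k _ ↦ (mul_pos (hpos k).1 (hpos k).2).ne'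
  have hunit : IsUnit B.det := hne.isUnit
  refine ⟨(isUnit_iff_isUnit_det B).mpr hunit, Polynomial.funext fun t ↦ ?_⟩
  apply mul_right_cancel₀ hne
  have hmul : (scalar _ t - (B⁻¹ - (1 / 2 : ℝ) • 1)) * B =
      (t - 1 / 2) • (1 : Matrix (Fin (2 * M) ⊕ Fin (2 * M)) (Fin (2 * M) ⊕ Fin (2 * M)) ℝ) -
        fromBlocks 0 1 1 0 * (((t + 1 / 2) * c) • fromBlocks A 0 0 A) := by
    rw [scalar_apply, ← smul_one_eq_diagonal, sub_mul, sub_mul, nonsing_inv_mul B hunit,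
      smul_mul_assoc, smul_mul_assoc, one_mul, hB, mul_smul_comm, mul_smul_comm]
    module
  rw [eval_charpoly, ← det_mul, hmul, det_fromBlocks_smul_of_charpoly_eq hlam, hdet, eval_prod,
    ← Finset.prod_mul_distrib]
  refine Finset.prod_congr rfl fun k _ ↦ ?_
  have h₁ := (hpos k).1.ne'
  have h₂ := (hpos k).2.ne'
  simp only [eval_mul, eval_sub, eval_X, eval_C]
  field_simp
  ring
end

section
/- Let A be a 2M×2M real symmetric matrix with eigenvalues λ₁,…,λ_{2M}, and let c > 0 satisfy c|λ_k| < 1 for all k. Then the matrix σ_{c(A⊕A)} = (I_{4M} − X_{4M}·c(A⊕A))^{−1} − (1/2)I_{4M} represents a pure Gaussian state: it satisfies (Z_{4M} σ_{c(A⊕A)})² = (1/4)·I_{4M}, i.e., all its symplectic eigenvalues equal 1/2. -/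
open Matrix

section

variable {n : Type*} [Fintype n] [DecidableEq n]

/-- `1 - s A` has nonzero determinant when no root `lam k` of the characteristic polynomial
satisfies `s * lam k = 1`. -/
lemma det_one_sub_smul_ne_zero {K : Type*} [Field K] (A : Matrix n n K) (lam : n → K)
    (hlam : A.charpoly = ∏ k : n, (Polynomial.X - Polynomial.C (lam k)))
    (s : K) (hs : ∀ k, s * lam k ≠ 1) : (1 - s • A).det ≠ 0 := by
  rcases eq_or_ne s 0 with rfl | h0
  · simp
  have h : (1 - s • A) = s • (scalar n s⁻¹ - A) := by
    rw [smul_sub, scalar_apply, ← smul_one_eq_diagonal, smul_smul, mul_inv_cancel₀ h0, one_smul]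
  rw [h, det_smul, ← eval_charpoly, hlam, Polynomial.eval_prod]
  refine mul_ne_zero (pow_ne_zero _ h0) (Finset.prod_ne_zero_iff.2 fun k _ => ?_)
  simp only [Polynomial.eval_sub, Polynomial.eval_X, Polynomial.eval_C]
  intro h
  apply hs k
  rw [← sub_eq_zero.1 h, mul_inv_cancel₀ h0]

/-- The block matrix `[[1, -B], [-B, 1]]` has nonzero determinant if `1 - B` and `1 + B` do. -/
lemma det_fromBlocks_one_neg_ne_zero {R : Type*} [CommRing R] [IsDomain R] (B : Matrix n n R)
    (h₁ : (1 - B).det ≠ 0) (h₂ : (1 + B).det ≠ 0) : (fromBlocks 1 (-B) (-B) 1).det ≠ 0 := by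
  rw [det_fromBlocks_one₁₁]
  have h : 1 - -B * -B = (1 - B) * (1 + B) := by noncomm_ring
  rw [h, det_mul]
  exact mul_ne_zero h₁ h₂

/-- If an involution `Z` intertwines `U` and `2 - U`, then `Z (U⁻¹ - 1/2)` squares to `1/4`. -/
lemma sq_mul_inv_sub_half {K : Type*} [Field K] [NeZero (2 : K)] (Z U : Matrix n n K)
    (hZ : Z * Z = 1) (hZU : Z * U + U * Z = Z + Z) (hU : IsUnit U.det) :
    (Z * (U⁻¹ - (1 / 2 : K) • 1)) ^ 2 = (1 / 4 : K) • 1 := by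
  have h2 : (2 : K) ≠ 0 := NeZero.ne 2
  have hUW := mul_nonsing_inv U hU
  have hWU := nonsing_inv_mul U hU
  generalize U⁻¹ = W at hUW hWU ⊢
  have hV : Z * W * Z * (2 - U) * W = W := by
    have hZV : Z * (2 - U) = U * Z := by
      rw [mul_sub, mul_two, ← hZU, add_sub_cancel_left]
    calc Z * W * Z * (2 - U) * W = Z * W * (Z * (2 - U)) * W := by noncomm_ring
      _ = Z * (W * U) * Z * W := by rw [hZV]; noncomm_ring
      _ = W := by rw [hWU, mul_one, hZ, one_mul]
  have hkey : (2 : K) • (Z * W * Z * W) = Z * W * Z + W := by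
    calc (2 : K) • (Z * W * Z * W) = Z * W * Z * (U * W) + Z * W * Z * (2 - U) * W := by
          rw [two_smul]; noncomm_ring
      _ = _ := by rw [hUW, mul_one, hV]
  have hkey' : Z * W * Z * W = (1 / 2 : K) • (Z * W * Z + W) := by
    rw [← hkey, smul_smul, one_div_mul_cancel h2, one_smul]
  have hexp : (Z * (W - (1 / 2 : K) • 1)) ^ 2 =
      Z * W * Z * W - (1 / 2 : K) • (Z * W * Z + Z * Z * W) +
        ((1 / 2 : K) * (1 / 2)) • (Z * Z) := by
    rw [pow_two]
    simp only [mul_sub, sub_mul, mul_smul_comm, smul_mul_assoc, mul_one, smul_add, smul_sub,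
      smul_smul, ← mul_assoc]
    abel
  rw [hexp, hZ, one_mul, hkey', sub_self, zero_add]
  congr 1
  rw [div_mul_div_comm]; norm_num

end

theorem stmt_11 (M : ℕ) (A : Matrix (Fin (2 * M)) (Fin (2 * M)) ℝ)
    (hA : A.IsSymm)
    (lam : Fin (2 * M) → ℝ)
    (hlam : A.charpoly = ∏ k : Fin (2 * M), (Polynomial.X - Polynomial.C (lam k)))
    (c : ℝ) (hc : 0 < c) (hclam : ∀ k, c * |lam k| < 1) :
    ((Matrix.fromBlocks 1 0 0 (-1) :
        Matrix (Fin (2 * M) ⊕ Fin (2 * M)) (Fin (2 * M) ⊕ Fin (2 * M)) ℝ) *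
      (((1 : Matrix (Fin (2 * M) ⊕ Fin (2 * M)) (Fin (2 * M) ⊕ Fin (2 * M)) ℝ) -
          Matrix.fromBlocks 0 1 1 0 * (c • Matrix.fromBlocks A 0 0 A))⁻¹ -
        (1 / 2 : ℝ) •
          (1 : Matrix (Fin (2 * M) ⊕ Fin (2 * M)) (Fin (2 * M) ⊕ Fin (2 * M)) ℝ))) ^ 2 =
      (1 / 4 : ℝ) •
        (1 : Matrix (Fin (2 * M) ⊕ Fin (2 * M)) (Fin (2 * M) ⊕ Fin (2 * M)) ℝ) := by
  have hN : (1 : Matrix (Fin (2 * M) ⊕ Fin (2 * M)) (Fin (2 * M) ⊕ Fin (2 * M)) ℝ) -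
      fromBlocks 0 1 1 0 * (c • fromBlocks A 0 0 A) =
        fromBlocks 1 (-(c • A)) (-(c • A)) 1 := by
    rw [fromBlocks_smul, fromBlocks_multiply, ← fromBlocks_one, sub_eq_add_neg,
      fromBlocks_neg, fromBlocks_add]
    simp
  have hlt : ∀ k, |c * lam k| < 1 := fun k => by
    rw [abs_mul, abs_of_pos hc]
    exact hclam k
  have h₁ : (1 - c • A).det ≠ 0 :=
    det_one_sub_smul_ne_zero A lam hlam c fun k => (abs_lt.1 (hlt k)).2.ne
  have h₂ : (1 + c • A).det ≠ 0 := by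
    rw [← sub_neg_eq_add, ← neg_smul]
    refine det_one_sub_smul_ne_zero A lam hlam (-c) fun k h => ?_
    linarith [(abs_lt.1 (hlt k)).1]
  rw [hN]
  apply sq_mul_inv_sub_half
  · simp [fromBlocks_multiply]
  · simp [fromBlocks_multiply, fromBlocks_add]
  · exact (det_fromBlocks_one_neg_ne_zero _ h₁ h₂).isUnit
end

section
/- Let A₁₁ and A₁₂ be commuting real symmetric M×M matrices with common orthonormal eigenbasis v₁,…,v_M, A₁₁ v_k = f_k v_k, A₁₂ v_k = h_k v_k, and let A = [[A₁₁, A₁₂],[A₁₂, A₁₁]]. Let c be a real number with c(h_k + f_k) ≠ 1 and c(h_k − f_k) ≠ −1 for all k. Then det(σ_{cA} + (1/2)I_{2M}) = Π_{k=1}^M 1/((1 − c(f_k + h_k))(1 + c(f_k − h_k))). -/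
open Matrix

theorem det_fromBlocks_self_swap {n R : Type*} [Fintype n] [DecidableEq n] [CommRing R]
    (A B : Matrix n n R) : (fromBlocks A B B A).det = (A + B).det * (A - B).det := by
  have key : fromBlocks 1 1 0 1 * fromBlocks A B B A * fromBlocks 1 (-1) 0 1 =
      fromBlocks (A + B) 0 B (A - B) := by
    rw [fromBlocks_multiply, fromBlocks_multiply]
    congr 1 <;> simp <;> abel
  simpa [det_mul, det_fromBlocks_zero₂₁, det_fromBlocks_zero₁₂] using congrArg det key

theorem det_eq_prod_of_orthonormal_mulVec {n R : Type*} [Fintype n] [DecidableEq n] [CommRing R]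
    (A : Matrix n n R) (v : n → n → R) (hv : ∀ k l, v k ⬝ᵥ v l = if k = l then 1 else 0)
    (d : n → R) (hd : ∀ k, A *ᵥ v k = d k • v k) : A.det = ∏ k, d k := by
  have hV : of v * (of v)ᵀ = 1 := by
    ext k l
    rw [one_apply]
    exact hv k l
  have hAV : A * (of v)ᵀ = (of v)ᵀ * diagonal d := by
    ext i k
    rw [mul_diagonal, mul_comm]
    exact congrFun (hd k) i
  have hdet : A = (of v)ᵀ * diagonal d * of v := by
    rw [← hAV, Matrix.mul_assoc, mul_eq_one_comm.mp hV, Matrix.mul_one]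
  rw [hdet, det_mul_right_comm, mul_eq_one_comm.mp hV, Matrix.one_mul, det_diagonal]

theorem stmt_14 (M : ℕ) (A11 A12 : Matrix (Fin M) (Fin M) ℝ)
    (h11 : A11.IsSymm) (h12 : A12.IsSymm) (hcomm : A11 * A12 = A12 * A11)
    (v : Fin M → Fin M → ℝ)
    (horth : ∀ k l, v k ⬝ᵥ v l = if k = l then (1 : ℝ) else 0)
    (f h : Fin M → ℝ)
    (hf : ∀ k, A11 *ᵥ v k = f k • v k)
    (hh : ∀ k, A12 *ᵥ v k = h k • v k)
    (c : ℝ)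
    (hc1 : ∀ k, c * (h k + f k) ≠ 1)
    (hc2 : ∀ k, c * (h k - f k) ≠ -1) :
    ((((1 : Matrix (Fin M ⊕ Fin M) (Fin M ⊕ Fin M) ℝ) -
          Matrix.fromBlocks 0 1 1 0 * (c • Matrix.fromBlocks A11 A12 A12 A11))⁻¹ -
        (1 / 2 : ℝ) • (1 : Matrix (Fin M ⊕ Fin M) (Fin M ⊕ Fin M) ℝ)) +
      (1 / 2 : ℝ) • (1 : Matrix (Fin M ⊕ Fin M) (Fin M ⊕ Fin M) ℝ)).det =
      ∏ k : Fin M, 1 / ((1 - c * (f k + h k)) * (1 + c * (f k - h k))) := by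
  have hA : ∀ s : ℝ, (1 - c • A12 + s • A11).det = ∏ k, (1 - c * h k + s * f k) := by
    intro s
    refine det_eq_prod_of_orthonormal_mulVec _ v horth _ fun k => ?_
    simp only [add_mulVec, sub_mulVec, one_mulVec, smul_mulVec, hf, hh, add_smul, sub_smul,
      one_smul, mul_smul]
  have hblock : (1 : Matrix (Fin M ⊕ Fin M) (Fin M ⊕ Fin M) ℝ) -
      fromBlocks 0 1 1 0 * (c • fromBlocks A11 A12 A12 A11) =
      fromBlocks (1 - c • A12) (-(c • A11)) (-(c • A11)) (1 - c • A12) := by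
    rw [← fromBlocks_one, fromBlocks_smul, fromBlocks_multiply, sub_eq_add_neg,
      fromBlocks_neg, fromBlocks_add]
    simp [sub_eq_add_neg]
  have hplus := hA (-c)
  rw [neg_smul] at hplus
  rw [sub_add_cancel, hblock, det_nonsing_inv, Ring.inverse_eq_inv', det_fromBlocks_self_swap,
    hplus, sub_neg_eq_add, hA c, ← Finset.prod_mul_distrib, ← Finset.prod_inv_distrib]
  refine Finset.prod_congr rfl fun k _ => ?_
  rw [one_div]
  congr 1
  ring
end

section
/- Let A be a 2M×2M real symmetric matrix with eigenvalues λ₁,…,λ_{2M}, and let c > 0 satisfy c|λ_k| < 1 for all k. Then det(σ_{c(A⊕A)} + (1/2)I_{4M}) = Π_{k=1}^{2M} 1/(1 − c²λ_k²). -/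
open Matrix

theorem Matrix.det_one_sub_smul_of_charpoly_eq_prod {n K : Type*} [Fintype n] [DecidableEq n]
    [Field K] (A : Matrix n n K) (lam : n → K)
    (hlam : A.charpoly = ∏ k, (Polynomial.X - Polynomial.C (lam k))) (t : K) :
    (1 - t • A).det = ∏ k, (1 - t * lam k) := by
  rcases eq_or_ne t 0 with rfl | ht
  · simp
  have h : 1 - t • A = t • (Matrix.scalar n t⁻¹ - A) := by
    rw [smul_sub, Matrix.scalar_apply, ← Matrix.smul_one_eq_diagonal, smul_smul,
      mul_inv_cancel₀ ht, one_smul]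
  rw [h, Matrix.det_smul, ← Matrix.eval_charpoly, hlam, Polynomial.eval_prod,
    ← Finset.card_univ, ← Finset.prod_const, ← Finset.prod_mul_distrib]
  refine Finset.prod_congr rfl fun k _ => ?_
  simp [mul_sub, mul_inv_cancel₀ ht]

theorem Matrix.one_sub_swap_mul_smul_fromBlocks_diag {n R : Type*} [Fintype n] [DecidableEq n]
    [CommRing R] (A : Matrix n n R) (c : R) :
    (1 : Matrix (n ⊕ n) (n ⊕ n) R) - fromBlocks 0 1 1 0 * (c • fromBlocks A 0 0 A) =
      fromBlocks 1 (-(c • A)) (-(c • A)) 1 := by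
  rw [fromBlocks_smul, fromBlocks_multiply, ← fromBlocks_one, sub_eq_add_neg, fromBlocks_neg,
    fromBlocks_add]
  simp

theorem Matrix.det_fromBlocks_one_neg_neg_one {n R : Type*} [Fintype n] [DecidableEq n]
    [CommRing R] (B : Matrix n n R) :
    (fromBlocks 1 (-B) (-B) 1).det = (1 - B).det * (1 + B).det := by
  rw [det_fromBlocks_one₁₁, ← det_mul]
  congr 1
  noncomm_ring


open Matrix

theorem stmt_15 (M : ℕ) (A : Matrix (Fin (2 * M)) (Fin (2 * M)) ℝ)
    (hA : A.IsSymm)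
    (lam : Fin (2 * M) → ℝ)
    (hlam : A.charpoly = ∏ k : Fin (2 * M), (Polynomial.X - Polynomial.C (lam k)))
    (c : ℝ) (hc : 0 < c) (hclam : ∀ k, c * |lam k| < 1) :
    ((((1 : Matrix (Fin (2 * M) ⊕ Fin (2 * M)) (Fin (2 * M) ⊕ Fin (2 * M)) ℝ) -
          Matrix.fromBlocks 0 1 1 0 * (c • Matrix.fromBlocks A 0 0 A))⁻¹ -
        (1 / 2 : ℝ) •
          (1 : Matrix (Fin (2 * M) ⊕ Fin (2 * M)) (Fin (2 * M) ⊕ Fin (2 * M)) ℝ)) +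
      (1 / 2 : ℝ) •
        (1 : Matrix (Fin (2 * M) ⊕ Fin (2 * M)) (Fin (2 * M) ⊕ Fin (2 * M)) ℝ)).det =
      ∏ k : Fin (2 * M), 1 / (1 - c ^ 2 * lam k ^ 2) := by
  rw [sub_add_cancel, det_nonsing_inv, Ring.inverse_eq_inv', one_sub_swap_mul_smul_fromBlocks_diag,
    det_fromBlocks_one_neg_neg_one, det_one_sub_smul_of_charpoly_eq_prod A lam hlam c,
    show 1 + c • A = 1 - (-c) • A by rw [neg_smul, sub_neg_eq_add],
    det_one_sub_smul_of_charpoly_eq_prod A lam hlam (-c), ← Finset.prod_mul_distrib,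
    ← Finset.prod_inv_distrib]
  refine Finset.prod_congr rfl fun k _ => ?_
  rw [one_div]
  ring
end
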